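/- Let g be a complex reductive Lie algebra with Cartan subalgebra h and Weyl group W, and V a finitely generated g-module. Then the set X = {χ ∈ h*/W : V/Ker(χ_χ)V ≠ 0} of infinitesimal characters of quotients of V coincides with the set of infinitesimal characters of subquotients of V: for any submodules V₂ ⊆ V₁ ⊆ V with V₁/V₂ having infinitesimal character χ, the module V itself admits a quotient with generalized infinitesimal character χ (in particular a quotient with infinitesimal character χ). -/

import Mathlib

set_option synthInstance.maxHeartbeats 1000000
set_option maxHeartbeats 2000000

open UniversalEnvelopingAlgebra

section AlmostCommutative

variable {k A ι : Type*} [Field k] [Ring A] [Algebra k A]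

/-- The span of the words of length less than `n` in the family `x`. -/
def wordSpan (k : Type*) {A ι : Type*} [Field k] [Ring A] [Algebra k A] (x : ι → A) (n : ℕ) :
    Submodule k A :=
  Submodule.span k {a | ∃ l : List ι, l.length < n ∧ (l.map x).prod = a}

/-- The product of the family `x` along some enumeration of the multiset of `m`. -/
noncomputable def wordMonomial (x : ι → A) (m : ι →₀ ℕ) : A :=
  ((Finsupp.toMultiset m).toList.map x).prod

lemma prod_mem_wordSpan (x : ι → A) {n : ℕ} (l : List ι) (hl : l.length < n) :
    (l.map x).prod ∈ wordSpan k x n :=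
  Submodule.subset_span ⟨l, hl, rfl⟩

lemma wordSpan_mul_prod (x : ι → A) {n : ℕ} (l : List ι) {a : A} (ha : a ∈ wordSpan k x n) :
    a * (l.map x).prod ∈ wordSpan k x (n + l.length) := by
  induction ha using Submodule.span_induction with
  | mem a h =>
    obtain ⟨l', hl', rfl⟩ := h
    rw [← List.prod_append, ← List.map_append]
    exact prod_mem_wordSpan x _ (by simpa using hl')
  | zero => simp
  | add a b _ _ ha hb => rw [add_mul]; exact add_mem ha hb
  | smul c a _ ha => rw [smul_mul_assoc]; exact Submodule.smul_mem _ _ ha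

lemma mul_mem_wordSpan (x : ι → A) {n : ℕ} (i : ι) {a : A} (ha : a ∈ wordSpan k x n) :
    x i * a ∈ wordSpan k x (n + 1) := by
  induction ha using Submodule.span_induction with
  | mem a h =>
    obtain ⟨l', hl', rfl⟩ := h
    rw [← List.prod_cons, ← List.map_cons]
    exact prod_mem_wordSpan x _ (by simpa using hl')
  | zero => simp
  | add a b _ _ ha hb => rw [mul_add]; exact add_mem ha hb
  | smul c a _ ha => rw [mul_smul_comm]; exact Submodule.smul_mem _ _ ha

lemma prod_sub_prod_mem_wordSpan_of_perm {x : ι → A}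
    (hx : ∀ i j, x i * x j - x j * x i ∈ wordSpan k x 2) {l l' : List ι} (h : l.Perm l') :
    (l.map x).prod - (l'.map x).prod ∈ wordSpan k x l.length := by
  induction h with
  | nil => simp
  | cons i h ih =>
    rw [List.map_cons, List.map_cons, List.prod_cons, List.prod_cons, ← mul_sub]
    exact mul_mem_wordSpan x i ih
  | swap i j l =>
    have := wordSpan_mul_prod x l (hx j i)
    simpa [sub_mul, mul_assoc, add_comm, add_left_comm] using this
  | trans h₁ h₂ ih₁ ih₂ =>
    rw [← h₁.length_eq] at ih₂
    simpa using add_mem ih₁ ih₂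

lemma length_toList_toMultiset (m : ι →₀ ℕ) :
    (Finsupp.toMultiset m).toList.length = m.degree := by
  rw [Multiset.length_toList, Finsupp.card_toMultiset]
  rfl

lemma wordSpan_le_span_wordMonomial {x : ι → A}
    (hx : ∀ i j, x i * x j - x j * x i ∈ wordSpan k x 2) (n : ℕ) :
    wordSpan k x n ≤ Submodule.span k (wordMonomial x '' {m | m.degree < n}) := by
  classical
  induction n with
  | zero => exact Submodule.span_le.2 fun a ⟨l, hl, _⟩ => absurd hl (Nat.not_lt_zero _)
  | succ n ih =>
    have ih' := ih.trans (Submodule.span_mono (Set.image_mono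
      (fun m (hm : m.degree < n) => (hm.trans n.lt_succ_self : m.degree < n + 1))))
    refine Submodule.span_le.2 ?_
    rintro _ ⟨l, hl, rfl⟩
    set m := Multiset.toFinsupp (l : Multiset ι) with hm
    have hp : l.Perm (Finsupp.toMultiset m).toList := by
      rw [← Multiset.coe_eq_coe]; simp [hm]
    have hd : m.degree < n + 1 := by
      rw [← length_toList_toMultiset, ← hp.length_eq]; exact hl
    have h₁ := prod_sub_prod_mem_wordSpan_of_perm hx hp
    have h₂ : wordSpan k x l.length ≤ wordSpan k x n :=
      Submodule.span_mono fun a ⟨l', hl', h⟩ => ⟨l', by omega, h⟩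
    have h₃ : wordMonomial x m ∈
        Submodule.span k (wordMonomial x '' {m | m.degree < n + 1}) :=
      Submodule.subset_span ⟨m, hd, rfl⟩
    rw [← sub_add_cancel (l.map x).prod (wordMonomial x m)]
    exact add_mem (ih' (h₂ h₁)) h₃

lemma span_range_wordMonomial_eq_top {x : ι → A}
    (hx : ∀ i j, x i * x j - x j * x i ∈ wordSpan k x 2)
    (hgen : Algebra.adjoin k (Set.range x) = ⊤) :
    Submodule.span k (wordMonomial x '' Set.univ) = ⊤ := by
  rw [eq_top_iff, ← Algebra.top_toSubmodule, ← hgen, Algebra.adjoin_eq_span]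
  refine Submodule.span_le.2 fun a ha => ?_
  obtain ⟨l, hl, rfl⟩ := Submonoid.exists_list_of_mem_closure ha
  obtain ⟨l, rfl⟩ : ∃ l' : List ι, l'.map x = l := by
    rw [← Set.mem_range, Set.range_list_map]; exact hl
  exact Submodule.span_mono (Set.image_mono (Set.subset_univ _))
    (wordSpan_le_span_wordMonomial hx _ (prod_mem_wordSpan x l l.length.lt_succ_self))

variable [LinearOrder ι] [Finite ι]

/-- The span of the monomials smaller than `m` for the degree lexicographic order. -/
noncomputable def lowerSpan (k : Type*) {A ι : Type*} [Field k] [Ring A] [Algebra k A]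
    [LinearOrder ι] [Finite ι] (x : ι → A) (m : ι →₀ ℕ) : Submodule k A :=
  Submodule.span k (wordMonomial x ''
    {m' | MonomialOrder.degLex.toSyn m' < MonomialOrder.degLex.toSyn m})

lemma wordSpan_degree_le_lowerSpan {x : ι → A}
    (hx : ∀ i j, x i * x j - x j * x i ∈ wordSpan k x 2) (m : ι →₀ ℕ) :
    wordSpan k x m.degree ≤ lowerSpan k x m := by
  refine (wordSpan_le_span_wordMonomial hx _).trans (Submodule.span_mono (Set.image_mono ?_))
  intro m' hm'
  exact MonomialOrder.degLex_lt_iff.2 (Finsupp.DegLex.lt_iff.2 (Or.inl hm'))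

lemma wordMonomial_mul_sub_mem_lowerSpan {x : ι → A}
    (hx : ∀ i j, x i * x j - x j * x i ∈ wordSpan k x 2) (e m : ι →₀ ℕ) :
    wordMonomial x e * wordMonomial x m - wordMonomial x (e + m) ∈ lowerSpan k x (e + m) := by
  have hp : ((Finsupp.toMultiset e).toList ++ (Finsupp.toMultiset m).toList).Perm
      (Finsupp.toMultiset (e + m)).toList := by
    rw [← Multiset.coe_eq_coe, ← Multiset.coe_add]; simp
  have h := prod_sub_prod_mem_wordSpan_of_perm hx hp
  rw [hp.length_eq, length_toList_toMultiset, List.map_append, List.prod_append] at h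
  exact wordSpan_degree_le_lowerSpan hx _ h

lemma wordMonomial_mul_mem_lowerSpan {x : ι → A}
    (hx : ∀ i j, x i * x j - x j * x i ∈ wordSpan k x 2) (e m : ι →₀ ℕ) {a : A}
    (ha : a ∈ lowerSpan k x m) : wordMonomial x e * a ∈ lowerSpan k x (e + m) := by
  induction ha using Submodule.span_induction with
  | mem a h =>
    obtain ⟨m', hm', rfl⟩ := h
    have hlt : MonomialOrder.degLex.toSyn (e + m') < MonomialOrder.degLex.toSyn (e + m) := by
      rw [map_add, map_add]; exact add_lt_add_right hm' _
    have h₁ : lowerSpan k x (e + m') ≤ lowerSpan k x (e + m) :=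
      Submodule.span_mono (Set.image_mono fun _ h => lt_trans h hlt)
    have h₂ : wordMonomial x (e + m') ∈ lowerSpan k x (e + m) :=
      Submodule.subset_span ⟨_, hlt, rfl⟩
    simpa using add_mem (h₁ (wordMonomial_mul_sub_mem_lowerSpan hx e m')) h₂
  | zero => simp
  | add a b _ _ ha hb => rw [mul_add]; exact add_mem ha hb
  | smul c a _ ha => rw [mul_smul_comm]; exact Submodule.smul_mem _ _ ha

lemma exists_leading_wordMonomial (x : ι → A) {S : Set (ι →₀ ℕ)} {a : A}
    (ha : a ∈ Submodule.span k (wordMonomial x '' S)) (h0 : a ≠ 0) :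
    ∃ m ∈ S, ∃ c : k, c ≠ 0 ∧ a - c • wordMonomial x m ∈ lowerSpan k x m := by
  obtain ⟨f, hf, rfl⟩ := (Finsupp.mem_span_image_iff_linearCombination k).1 ha
  have hne : f.support.Nonempty := by
    rw [Finsupp.support_nonempty_iff]; rintro rfl; simp at h0
  obtain ⟨m, hm, hmax⟩ := f.support.exists_max_image MonomialOrder.degLex.toSyn hne
  refine ⟨m, (Finsupp.mem_supported k f).1 hf hm, f m, Finsupp.mem_support_iff.1 hm, ?_⟩
  rw [Finsupp.linearCombination_apply, Finsupp.sum, ← Finset.add_sum_erase _ _ hm,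
    add_sub_cancel_left]
  refine Submodule.sum_mem _ fun m' hm' => Submodule.smul_mem _ _ (Submodule.subset_span
    ⟨m', ?_, rfl⟩)
  rw [Finset.mem_erase] at hm'
  exact lt_of_le_of_ne (hmax m' hm'.2) fun h => hm'.1 (MonomialOrder.degLex.toSyn.injective h)

/-- An algebra generated by finitely many elements whose commutators are affine combinations of
the generators is left Noetherian. -/
theorem isNoetherianRing_of_commutator_mem_wordSpan {x : ι → A}
    (hx : ∀ i j, x i * x j - x j * x i ∈ wordSpan k x 2)
    (hgen : Algebra.adjoin k (Set.range x) = ⊤) : IsNoetherianRing A := by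
  rw [isNoetherianRing_iff_ideal_fg]
  intro I
  let E : Set (ι →₀ ℕ) := {m | ∃ a ∈ I, wordMonomial x m - a ∈ lowerSpan k x m}
  have hfin : {m | Minimal (· ∈ E) m}.Finite :=
    WellQuasiOrderedLE.finite_of_isAntichain (setOfPred_minimal_antichain _)
  choose! g hgI hg using fun (m : ι →₀ ℕ) (hm : m ∈ E) => hm
  have key : ∀ (s : MonomialOrder.degLex.syn) (m : ι →₀ ℕ),
      MonomialOrder.degLex.toSyn m = s → ∀ a ∈ I, ∀ c : k, c ≠ 0 →
      a - c • wordMonomial x m ∈ lowerSpan k x m →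
      a ∈ Ideal.span (g '' {m | Minimal (· ∈ E) m}) := by
    intro s
    induction s using WellFoundedLT.induction with
    | ind s ih =>
    rintro m rfl a ha c hc hac
    have hmE : m ∈ E := by
      refine ⟨c⁻¹ • a, ?_, ?_⟩
      · rw [Algebra.smul_def]; exact I.mul_mem_left _ ha
      · have := Submodule.smul_mem _ (-c⁻¹) hac
        rwa [smul_sub, smul_smul, neg_mul, inv_mul_cancel₀ hc, neg_one_smul, sub_neg_eq_add,
          neg_smul, neg_add_eq_sub] at this
    obtain ⟨m₀, hle, hm₀⟩ := exists_minimal_le_of_wellFoundedLT (· ∈ E) m hmE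
    obtain ⟨e, rfl⟩ := exists_add_of_le hle
    rw [add_comm] at hac ih
    have hgm : g m₀ ∈ Ideal.span (g '' {m | Minimal (· ∈ E) m}) :=
      Ideal.subset_span ⟨m₀, hm₀, rfl⟩
    have hb : c • (wordMonomial x e * g m₀) = (algebraMap k A c * wordMonomial x e) * g m₀ := by
      rw [Algebra.smul_def, mul_assoc]
    have hrest : a - c • (wordMonomial x e * g m₀) ∈ lowerSpan k x (e + m₀) := by
      have h₁ := wordMonomial_mul_sub_mem_lowerSpan hx e m₀
      have h₂ := wordMonomial_mul_mem_lowerSpan hx e m₀ (hg m₀ hm₀.prop)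
      have h := add_mem hac (Submodule.smul_mem _ c (sub_mem h₂ h₁))
      convert h using 1
      rw [mul_sub, smul_sub, smul_sub, smul_sub]
      abel
    have hspan : a - c • (wordMonomial x e * g m₀) ∈
        Ideal.span (g '' {m | Minimal (· ∈ E) m}) := by
      by_cases h0 : a - c • (wordMonomial x e * g m₀) = 0
      · rw [h0]; exact zero_mem _
      · obtain ⟨m', hm', c', hc', h'⟩ := exists_leading_wordMonomial x hrest h0
        refine ih _ hm' m' rfl _ (sub_mem ha ?_) c' hc' h'
        rw [hb]; exact I.mul_mem_left _ (hgI m₀ hm₀.prop)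
    rw [hb] at hspan
    simpa using add_mem hspan (Ideal.mul_mem_left _ (algebraMap k A c * wordMonomial x e) hgm)
  refine (Submodule.fg_def).2 ⟨_, hfin.image g, le_antisymm ?_ ?_⟩
  · refine Submodule.span_le.2 ?_
    rintro _ ⟨m, hm, rfl⟩
    exact hgI m hm.prop
  · intro a ha
    by_cases h0 : a = 0
    · rw [h0]; exact zero_mem _
    · have hmem : a ∈ Submodule.span k (wordMonomial x '' Set.univ) := by
        rw [span_range_wordMonomial_eq_top hx hgen]; trivial
      obtain ⟨m, -, c, hc, h⟩ := exists_leading_wordMonomial x hmem h0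
      exact key _ m rfl a ha c hc h

end AlmostCommutative

namespace UniversalEnvelopingAlgebra

variable (k L : Type*) [Field k] [LieRing L] [LieAlgebra k L]

lemma adjoin_range_ι :
    Algebra.adjoin k (Set.range (ι k : L → UniversalEnvelopingAlgebra k L)) = ⊤ := by
  have hsurj : Function.Surjective (mkAlgHom k L) := RingCon.mkₐ_surjective _
  have h := congrArg (Subalgebra.map (mkAlgHom k L))
    (TensorAlgebra.adjoin_range_ι (R := k) (M := L))
  rw [AlgHom.map_adjoin, Algebra.map_top, (AlgHom.range_eq_top _).2 hsurj, ← Set.range_comp] at h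
  exact h

attribute [local instance] LieRing.ofAssociativeRing

theorem isNoetherianRing [FiniteDimensional k L] :
    IsNoetherianRing (UniversalEnvelopingAlgebra k L) := by
  let b := Module.finBasis k L
  let x := fun i => ι k (b i)
  let f : L →ₗ[k] UniversalEnvelopingAlgebra k L := (ι k).toLinearMap
  have hL : ∀ v : L, ι k v ∈ Submodule.span k (Set.range x) := fun v => by
    have h : f v ∈ (Submodule.span k (Set.range b)).map f :=
      Submodule.mem_map_of_mem (by rw [b.span_eq]; trivial)
    rwa [Submodule.map_span, ← Set.range_comp] at h
  refine isNoetherianRing_of_commutator_mem_wordSpan (k := k) (x := x) (fun i j => ?_) ?_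
  · have h : x i * x j - x j * x i = ι k ⁅b i, b j⁆ := by
      rw [LieHom.map_lie, LieRing.of_associative_ring_bracket]
    rw [h]
    refine Submodule.span_mono ?_ (hL _)
    rintro _ ⟨i, rfl⟩
    exact ⟨[i], by simp, by simp⟩
  · rw [eq_top_iff, ← adjoin_range_ι k L, Algebra.adjoin_le_iff]
    rintro _ ⟨v, rfl⟩
    exact Algebra.span_le_adjoin k _ (hL v)

end UniversalEnvelopingAlgebra

section Center

variable {R M : Type*} [Ring R] [AddCommGroup M] [Module R M]

lemma Subring.smul_center_smul_comm (r : R) (z : Subring.center R) (v : M) :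
    r • z • v = z • r • v := by
  rw [Subring.smul_def, Subring.smul_def, smul_smul, smul_smul,
    Subring.mem_center_iff.1 z.2 r]

/-- Multiplication by a central element, as a linear map. -/
def centerSMul (M : Type*) [AddCommGroup M] [Module R M] (z : Subring.center R) :
    Module.End R M where
  toFun v := z • v
  map_add' := smul_add z
  map_smul' r v := (Subring.smul_center_smul_comm r z v).symm

lemma centerSMul_pow_apply (z : Subring.center R) (n : ℕ) (v : M) :
    (centerSMul M z ^ n) v = z ^ n • v := by
  induction n generalizing v with
  | zero => simp
  | succ n ih => rw [pow_succ, Module.End.mul_apply, ih, pow_succ, mul_smul]; rfl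

lemma exists_fg_le_smul_top_eq [IsNoetherian R M] (I : Ideal (Subring.center R)) :
    ∃ J ≤ I, J.FG ∧
      I • (⊤ : Submodule (Subring.center R) M) = J • (⊤ : Submodule (Subring.center R) M) := by
  classical
  let s : Set M := {w | ∃ z ∈ I, ∃ v : M, z • v = w}
  obtain ⟨t, hts, hst⟩ := Submodule.fg_span_iff_fg_span_finset_subset s |>.1
    (IsNoetherian.noetherian (Submodule.span R s))
  choose! g hgI w hgw using fun (a : M) (ha : a ∈ s) => ha
  have hJI : Ideal.span (g '' t) ≤ I := by
    refine Ideal.span_le.2 ?_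
    rintro _ ⟨a, ha, rfl⟩
    exact hgI a (hts ha)
  refine ⟨Ideal.span (g '' t), hJI, Submodule.fg_span (t.finite_toSet.image g),
    le_antisymm ?_ (Submodule.smul_mono_left hJI)⟩
  refine Submodule.smul_le.2 fun z hz v _ => ?_
  generalize hu : z • v = u
  have hzv : u ∈ Submodule.span R (t : Set M) := hst ▸ Submodule.subset_span ⟨z, hz, v, hu⟩
  clear hu
  induction hzv using Submodule.span_induction with
  | mem a ha =>
    rw [← hgw a (hts ha)]
    exact Submodule.smul_mem_smul (Ideal.subset_span ⟨a, ha, rfl⟩) trivial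
  | zero => exact zero_mem _
  | add a b _ _ ha hb => exact add_mem ha hb
  | smul r a _ ha =>
    refine Submodule.smul_induction_on ha (fun z hz v _ => ?_) fun a b ha hb => ?_
    · rw [Subring.smul_center_smul_comm]
      exact Submodule.smul_mem_smul hz trivial
    · rw [smul_add]; exact add_mem ha hb

lemma pow_smul_top_eq_of_smul_top_eq {C : Type*} [CommRing C] [Module C M] {I J : Ideal C}
    (h : I • (⊤ : Submodule C M) = J • ⊤) (n : ℕ) :
    I ^ n • (⊤ : Submodule C M) = J ^ n • ⊤ := by
  induction n with
  | zero => simp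
  | succ n ih =>
    rw [pow_succ, Submodule.mul_smul, h, ← Submodule.mul_smul, mul_comm, Submodule.mul_smul, ih,
      ← Submodule.mul_smul, ← pow_succ']

/-- If an ideal of the center kills an essential submodule of a Noetherian module, then one of its
powers kills the whole module. -/
theorem exists_pow_smul_eq_zero_of_essential [IsNoetherian R M] (I : Ideal (Subring.center R))
    (S : Submodule R M) (hS : ∀ P : Submodule R M, Disjoint S P → P = ⊥)
    (hI : ∀ z ∈ I, ∀ v ∈ S, z • v = 0) :
    ∃ n : ℕ, ∀ z ∈ I ^ n, ∀ v : M, z • v = 0 := by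
  have hrad : I ≤ (Module.annihilator (Subring.center R) M).radical := by
    intro z hz
    obtain ⟨n, hn, hn1⟩ := ((centerSMul M z).eventually_disjoint_ker_pow_range_pow.and
      (Filter.eventually_ge_atTop 1)).exists
    have hbot : LinearMap.range (centerSMul M z ^ n) = ⊥ := by
      refine hS _ (hn.mono_left fun v hv => ?_)
      rw [LinearMap.mem_ker, centerSMul_pow_apply, ← Nat.sub_add_cancel hn1, pow_succ, mul_smul,
        hI z hz v hv, smul_zero]
    refine ⟨n, Module.mem_annihilator.2 fun v => ?_⟩
    rw [← centerSMul_pow_apply, LinearMap.range_eq_bot.1 hbot, LinearMap.zero_apply]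
  obtain ⟨J, hJI, hJ, hIJ⟩ := exists_fg_le_smul_top_eq (M := M) I
  obtain ⟨n, hn⟩ := Ideal.exists_pow_le_of_le_radical_of_fg (hJI.trans hrad) hJ
  refine ⟨n, fun z hz v => ?_⟩
  have h : z • v ∈ J ^ n • (⊤ : Submodule (Subring.center R) M) :=
    pow_smul_top_eq_of_smul_top_eq hIJ n ▸ Submodule.smul_mem_smul hz trivial
  have hle : J ^ n • (⊤ : Submodule (Subring.center R) M) ≤ ⊥ :=
    Submodule.smul_le.2 fun y hy w _ => Module.mem_annihilator.1 (hn hy) w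
  exact hle h

end Center

/-- equation (3.1) in Lemma `FiniteGenDenseQuot`.
Let `g` be a complex reductive Lie algebra and `V` a finitely generated `g`-module.
If `V₂ ⊆ V₁ ⊆ V` are submodules with `V₂ ≠ V₁` such that the subquotient `V₁/V₂` has
infinitesimal character `χ` (the center `Z(g)` acts on it through the character `χ`),
then `V` admits a proper quotient `V/N` with generalized infinitesimal character `χ`:
some power of `Ker χ ⊆ Z(g)` maps `V` into `N`. -/
theorem quotient_with_generalized_infinitesimal_character_of_subquotient
    (L : Type*) [LieRing L] [LieAlgebra ℂ L] [FiniteDimensional ℂ L]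
    (V : Type*) [AddCommGroup V] [Module ℂ V]
    [Module (UniversalEnvelopingAlgebra ℂ L) V]
    [IsScalarTower ℂ (UniversalEnvelopingAlgebra ℂ L) V]
    [Module.Finite (UniversalEnvelopingAlgebra ℂ L) V]
    (V₁ V₂ : Submodule (UniversalEnvelopingAlgebra ℂ L) V)
    (h21 : V₂ ≤ V₁) (hne : V₂ ≠ V₁)
    (χ : Subring.center (UniversalEnvelopingAlgebra ℂ L) →+* ℂ)
    (hchar : ∀ z : Subring.center (UniversalEnvelopingAlgebra ℂ L), ∀ v ∈ V₁,
      (z : UniversalEnvelopingAlgebra ℂ L) • v - χ z • v ∈ V₂) :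
    ∃ N : Submodule (UniversalEnvelopingAlgebra ℂ L) V, N ≠ ⊤ ∧
      ∃ n : ℕ, ∀ z ∈ (RingHom.ker χ) ^ n, ∀ v : V,
        ((z : Subring.center (UniversalEnvelopingAlgebra ℂ L)) :
          UniversalEnvelopingAlgebra ℂ L) • v ∈ N := by
  have := UniversalEnvelopingAlgebra.isNoetherianRing ℂ L
  have hV : IsNoetherian (UniversalEnvelopingAlgebra ℂ L) V := inferInstance
  obtain ⟨N, hN, hmax⟩ := exists_maximal_ge_of_wellFoundedGT
    (fun N : Submodule (UniversalEnvelopingAlgebra ℂ L) V => N ⊓ V₁ ≤ V₂) V₂ inf_le_left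
  refine ⟨N, ?_, ?_⟩
  · rintro rfl
    exact hne (le_antisymm h21 (by simpa using hmax.prop))
  · have hess : ∀ P : Submodule (UniversalEnvelopingAlgebra ℂ L) (V ⧸ N),
        Disjoint (V₁.map N.mkQ) P → P = ⊥ := by
      intro P hP
      have hle : P.comap N.mkQ ≤ N := by
        refine hmax.le_of_ge (fun v hv => hmax.prop ⟨?_, hv.2⟩) (N.le_comap_mkQ P)
        exact (Submodule.Quotient.mk_eq_zero N).1
          ((Submodule.disjoint_def.1 hP) _ ⟨v, hv.2, rfl⟩ hv.1)
      refine (Submodule.eq_bot_iff P).2 fun p hp => ?_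
      obtain ⟨v, rfl⟩ := N.mkQ_surjective p
      exact (Submodule.Quotient.mk_eq_zero N).2 (hle hp)
    have hker : ∀ z ∈ RingHom.ker χ, ∀ v ∈ V₁.map N.mkQ, z • v = 0 := by
      rintro z hz _ ⟨v, hv, rfl⟩
      have h := hchar z v hv
      rw [RingHom.mem_ker.1 hz, zero_smul, sub_zero] at h
      exact (Submodule.Quotient.mk_eq_zero N).2 (hN h)
    obtain ⟨n, hn⟩ := exists_pow_smul_eq_zero_of_essential (RingHom.ker χ) _ hess hker
    refine ⟨n, fun z hz v => ?_⟩
    rw [← Submodule.Quotient.mk_eq_zero]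
    exact hn z hz (N.mkQ v)
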